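/- (Left rationality and coassociativity for comodules.) Let (V, Y_V, c) be a graded vertex coalgebra and let M be a ℚ-graded vector space with Y_M satisfying all the axioms of a comodule over V except possibly the Jacobi identity, and additionally satisfying weak coassociativity (for every v' ∈ (V ⊗ V ⊗ M)' there is k ∈ ℤ_+ with (x_0+x_2)^k ⟨v', (Y_V(x_0)⊗Id_M)Y_M(x_2)w − (Id_V⊗Y_M(x_2))Y_M(x_0+x_2)w⟩ = 0 for all w). Then for every v' ∈ (V ⊗ V ⊗ M)' and w ∈ M: (a) ⟨v', (Y_V(x_0) ⊗ Id_M)Y_M(x_2)w⟩ lies in F[x_0^{-1},x_2][[x_0,x_2^{-1}]] and equals ι_{20}k(x_0,x_2) for a uniquely determined k ∈ F[x_0,x_2]_S of the form h(x_0,x_2)/(x_0^r x_2^s (x_0+x_2)^t); and (b) ι_{12}^{-1}⟨v', (Id_V ⊗ Y_M(x_2))Y_M(x_1)w⟩ = (ι_{20}^{-1}⟨v', (Y_V(x_0) ⊗ Id_M)Y_M(x_2)w⟩)|_{x_0 = x_1 − x_2} as rational functions. -/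

import Mathlib

/- Common background for the formalization of "Vertex coalgebras, comodules,
cocommutativity and coassociativity" (K. Hubbard).

A vertex coalgebra `(V, Y, c)` is encoded by the family of coefficient maps
`Δ k : V →ₗ V ⊗ V` of the coproduct `Y(x)v = ∑ₖ Δ k v · x^(-k-1)` together with
the covacuum `c : V →ₗ F`.  All identities of formal series are encoded
coefficient-wise; in particular the Jacobi identity is encoded by its
(dual Borcherds) coefficient form. -/

noncomputable section

open scoped TensorProduct

variable (F : Type) [Field F] [CharZero F]

/-- The generalized binomial coefficient `(a choose i)` as an element of `F`. -/
def gchoose (a : ℤ) (i : ℕ) : F :=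
  (∏ j ∈ Finset.range i, ((a : F) - (j : F))) / (Nat.factorial i : F)

variable {V M : Type} [AddCommGroup V] [Module F V] [AddCommGroup M] [Module F M]

/-- `c ⊗ Id` composed with the canonical identification `F ⊗ M ≃ M`. -/
def cLeft (c : V →ₗ[F] F) : V ⊗[F] M →ₗ[F] M :=
  (TensorProduct.lid F M).toLinearMap ∘ₗ TensorProduct.map c LinearMap.id

/-- `Id ⊗ c` composed with the canonical identification `V ⊗ F ≃ V`. -/
def cRight (c : M →ₗ[F] F) : V ⊗[F] M →ₗ[F] V :=
  (TensorProduct.rid F V).toLinearMap ∘ₗ TensorProduct.map LinearMap.id c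

/-- The transposition `T ⊗ Id` of the first two tensor factors of `V ⊗ (V ⊗ M)`. -/
def Tfirst : V ⊗[F] (V ⊗[F] M) →ₗ[F] V ⊗[F] (V ⊗[F] M) :=
  (TensorProduct.assoc F V V M).toLinearMap ∘ₗ
    TensorProduct.map (TensorProduct.comm F V V).toLinearMap LinearMap.id ∘ₗ
    (TensorProduct.assoc F V V M).symm.toLinearMap

/-- The coefficient of `x₁^(-m-1) x₂^(-n-1)` in `(Id ⊗ Y(x₂)) Y(x₁)`. -/
def comp12 (ΔM : ℤ → M →ₗ[F] V ⊗[F] M) (m n : ℤ) : M →ₗ[F] V ⊗[F] (V ⊗[F] M) :=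
  TensorProduct.map LinearMap.id (ΔM n) ∘ₗ ΔM m

/-- The coefficient of `x₀^(-m-1) x₂^(-n-1)` in `(Y(x₀) ⊗ Id) Y(x₂)`. -/
def compR (ΔV : ℤ → V →ₗ[F] V ⊗[F] V) (ΔM : ℤ → M →ₗ[F] V ⊗[F] M) (m n : ℤ) :
    M →ₗ[F] V ⊗[F] (V ⊗[F] M) :=
  (TensorProduct.assoc F V V M).toLinearMap ∘ₗ TensorProduct.map (ΔV m) LinearMap.id ∘ₗ ΔM n

/-- The coefficient form of the (comodule) Jacobi identity of a vertex coalgebra,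
obtained by extracting the coefficient of `x₀^(-a-1) x₁^(-b-1) x₂^(-c-1)`. -/
def JacobiId (ΔV : ℤ → V →ₗ[F] V ⊗[F] V) (ΔM : ℤ → M →ₗ[F] V ⊗[F] M) : Prop :=
  ∀ (a b c : ℤ) (w : M),
    (∑ᶠ i : ℕ, ((-1 : F) ^ i * gchoose F a i) •
        (comp12 F ΔM (a + b - i) (c + i) w -
          (-1 : F) ^ a • Tfirst F (comp12 F ΔM (a + c - i) (b + i) w))) =
      ∑ᶠ i : ℕ, gchoose F b i • compR F ΔV ΔM (a + i) (b + c - i) w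

/-- The axioms of a vertex coalgebra except the Jacobi identity: left counit,
cocreation and truncation, in coefficient form. -/
def IsVertexCoalgSansJacobi (Δ : ℤ → V →ₗ[F] V ⊗[F] V) (c : V →ₗ[F] F) : Prop :=
  (∀ v : V, cLeft F c (Δ (-1) v) = v) ∧
  (∀ k : ℤ, k ≠ -1 → ∀ v : V, cLeft F c (Δ k v) = 0) ∧
  (∀ v : V, cRight F c (Δ (-1) v) = v) ∧
  (∀ k : ℤ, 0 ≤ k → ∀ v : V, cRight F c (Δ k v) = 0) ∧
  (∀ v : V, ∃ N : ℤ, ∀ k : ℤ, k < N → Δ k v = 0)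

/-- The axioms of a vertex coalgebra. -/
def IsVertexCoalg (Δ : ℤ → V →ₗ[F] V ⊗[F] V) (c : V →ₗ[F] F) : Prop :=
  IsVertexCoalgSansJacobi F Δ c ∧ JacobiId F Δ Δ

/-- The weight-`m` component of `V ⊗ V` for a graded space `V`. -/
def grT2 (gr : ℤ → Submodule F V) (m : ℤ) : Submodule F (V ⊗[F] V) :=
  ⨆ p : ℤ, LinearMap.range (TensorProduct.map (gr p).subtype (gr (m - p)).subtype)

/-- The weight-`m` component of `V ⊗ (V ⊗ V)` for a graded space `V`. -/
def grT3 (gr : ℤ → Submodule F V) (m : ℤ) : Submodule F (V ⊗[F] (V ⊗[F] V)) :=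
  ⨆ p : ℤ × ℤ, LinearMap.range (TensorProduct.map (gr p.1).subtype
    (TensorProduct.map (gr p.2).subtype (gr (m - p.1 - p.2)).subtype))

/-- The grading axioms of a graded vertex coalgebra: `V = ⊕ₖ V₍ₖ₎` internally,
`V₍ₖ₎ = 0` for `k` sufficiently small, and `Δ k` raises weight by `k + 1`. -/
def IsGradedVC (Δ : ℤ → V →ₗ[F] V ⊗[F] V) (gr : ℤ → Submodule F V) : Prop :=
  DirectSum.IsInternal gr ∧ (∃ N : ℤ, ∀ k : ℤ, k < N → gr k = ⊥) ∧
  (∀ r k : ℤ, ∀ v ∈ gr r, Δ k v ∈ grT2 F gr (r + k + 1))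

/-- `f` belongs to the graded dual `(V^{⊗3})'`: it vanishes on all but finitely
many homogeneous components of `V ⊗ V ⊗ V`. -/
def GradedDual3 (gr : ℤ → Submodule F V) (f : V ⊗[F] (V ⊗[F] V) →ₗ[F] F) : Prop :=
  ∃ s : Finset ℤ, ∀ m : ℤ, m ∉ s → ∀ u ∈ grT3 F gr m, f u = 0

/-- The weight-`q` component of `V ⊗ M` for `V` a `ℤ`-graded space and
`M` a `ℚ`-graded space. -/
def grVM (gr : ℤ → Submodule F V) (grM : ℚ → Submodule F M) (q : ℚ) :
    Submodule F (V ⊗[F] M) :=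
  ⨆ p : ℤ, LinearMap.range (TensorProduct.map (gr p).subtype (grM (q - p)).subtype)

/-- The weight-`q` component of `V ⊗ (V ⊗ M)`. -/
def grVVM (gr : ℤ → Submodule F V) (grM : ℚ → Submodule F M) (q : ℚ) :
    Submodule F (V ⊗[F] (V ⊗[F] M)) :=
  ⨆ p : ℤ × ℤ, LinearMap.range (TensorProduct.map (gr p.1).subtype
    (TensorProduct.map (gr p.2).subtype (grM (q - p.1 - p.2)).subtype))

/-- `f` belongs to the graded dual `(V ⊗ V ⊗ M)'`. -/
def GradedDualVVM (gr : ℤ → Submodule F V) (grM : ℚ → Submodule F M)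
    (f : V ⊗[F] (V ⊗[F] M) →ₗ[F] F) : Prop :=
  ∃ s : Finset ℚ, ∀ q : ℚ, q ∉ s → ∀ u ∈ grVVM F gr grM q, f u = 0

/-- The axioms of a comodule over a graded vertex coalgebra, except the Jacobi
identity: left counit, truncation, internal `ℚ`-grading bounded below, and the
grading condition on the comodule coproduct. -/
def IsComoduleSansJacobi (c : V →ₗ[F] F) (ΔM : ℤ → M →ₗ[F] V ⊗[F] M)
    (gr : ℤ → Submodule F V) (grM : ℚ → Submodule F M) : Prop :=
  (∀ w : M, cLeft F c (ΔM (-1) w) = w) ∧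
  (∀ k : ℤ, k ≠ -1 → ∀ w : M, cLeft F c (ΔM k w) = 0) ∧
  (∀ w : M, ∃ N : ℤ, ∀ k : ℤ, k < N → ΔM k w = 0) ∧
  DirectSum.IsInternal grM ∧ (∃ N : ℚ, ∀ q : ℚ, q < N → grM q = ⊥) ∧
  (∀ (j : ℚ) (k : ℤ), ∀ w ∈ grM j, ΔM k w ∈ grVM F gr grM (j + k + 1))

/-- Weak cocommutativity with exponent `k`, paired against `f`, coefficient-wise:
the coefficient of `x₁^(-b-1) x₂^(-c-1)` in
`(x₁-x₂)^k ⟨f, (Id ⊗ Y(x₂))Y(x₁)w - (T ⊗ Id)(Id ⊗ Y(x₁))Y(x₂)w⟩` vanishes. -/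
def WeakCocom (ΔM : ℤ → M →ₗ[F] V ⊗[F] M) (f : V ⊗[F] (V ⊗[F] M) →ₗ[F] F)
    (k : ℕ) : Prop :=
  ∀ (w : M) (b c : ℤ),
    ∑ j ∈ Finset.range (k + 1), ((-1 : F) ^ j * (k.choose j : F)) *
      (f (comp12 F ΔM (b + k - j) (c + j) w) -
        f (Tfirst F (comp12 F ΔM (c + j) (b + k - j) w))) = 0

/-- Weak coassociativity with exponent `k`, paired against `f`, coefficient-wise:
the coefficient of `x₀^(-a-1) x₂^(-c-1)` in
`(x₀+x₂)^k ⟨f, (Y(x₀) ⊗ Id)Y(x₂)w - (Id ⊗ Y(x₂))Y(x₀+x₂)w⟩` vanishes,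
`Y(x₀+x₂)` being expanded in nonnegative integral powers of `x₂`. -/
def WeakCoassoc (ΔV : ℤ → V →ₗ[F] V ⊗[F] V) (ΔM : ℤ → M →ₗ[F] V ⊗[F] M)
    (f : V ⊗[F] (V ⊗[F] M) →ₗ[F] F) (k : ℕ) : Prop :=
  ∀ (w : M) (a c : ℤ),
    ∑ j ∈ Finset.range (k + 1), (k.choose j : F) *
      (f (compR F ΔV ΔM (a + k - j) (c + j) w) -
        ∑ᶠ i : ℕ, ((-1 : F) ^ i * gchoose F (a + k - j) i) *
          f (comp12 F ΔM (a + k - j - i) (c + j + i) w)) = 0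

/-- The coefficient function of `x^r y^s (x + ε y)^t · A`, where `A : ℤ → ℤ → F`
is the coefficient function of a formal series (`A m n` is the coefficient of
`x^m y^n`). -/
def mulPoly (r s t : ℕ) (ε : F) (A : ℤ → ℤ → F) (m n : ℤ) : F :=
  ∑ j ∈ Finset.range (t + 1), (t.choose j : F) * ε ^ j *
    A (m - (r : ℤ) - ((t - j : ℕ) : ℤ)) (n - (s : ℤ) - (j : ℤ))

/-- `g` is the coefficient function of a polynomial in two variables. -/
def IsPolyCoeff (g : ℤ → ℤ → F) : Prop :=
  {p : ℤ × ℤ | g p.1 p.2 ≠ 0}.Finite ∧ ∀ m n : ℤ, m < 0 ∨ n < 0 → g m n = 0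

/-- The coefficient function of the polynomial `h(x₁ - x₂, x₂)` in the
variables `x₁, x₂`, given the coefficient function of `h = h(x₀, x₂)`. -/
def substC (h : ℤ → ℤ → F) (m n : ℤ) : F :=
  ∑ᶠ j : ℕ, ((-1 : F) ^ j * gchoose F (m + j) j) * h (m + j) (n - j)

/-- The coefficient form of the Jacobi identity of a vertex algebra (the
Borcherds identity). -/
def VAJacobi (mul : ℤ → V →ₗ[F] V →ₗ[F] V) : Prop :=
  ∀ (a b c : ℤ) (u v w : V),
    (∑ᶠ i : ℕ, ((-1 : F) ^ i * gchoose F a i) •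
        (mul (a + b - i) u (mul (c + i) v w) -
          (-1 : F) ^ a • mul (a + c - i) v (mul (b + i) u w))) =
      ∑ᶠ i : ℕ, gchoose F b i • mul (b + c - i) (mul (a + i) u v) w

/-- The axioms of a vertex algebra: truncation, vacuum, creation and the Jacobi
identity, in coefficient form (`mul n u v` is `u_n v`). -/
def IsVA (mul : ℤ → V →ₗ[F] V →ₗ[F] V) (one : V) : Prop :=
  (∀ u v : V, ∃ N : ℤ, ∀ n : ℤ, N < n → mul n u v = 0) ∧
  (∀ v : V, mul (-1) one v = v) ∧
  (∀ n : ℤ, n ≠ -1 → ∀ v : V, mul n one v = 0) ∧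
  (∀ v : V, mul (-1) v one = v) ∧
  (∀ n : ℤ, 0 ≤ n → ∀ v : V, mul n v one = 0) ∧
  VAJacobi F mul

/-- The graded dual `V' = ⊕ₖ V₍ₖ₎*`, realized as the submodule of the full dual
consisting of functionals vanishing on all but finitely many components. -/
def gradedDual (gr : ℤ → Submodule F V) : Submodule F (Module.Dual F V) where
  carrier := {φ | ∃ s : Finset ℤ, ∀ k ∉ s, ∀ u ∈ gr k, φ u = 0}
  zero_mem' := ⟨∅, by intro k _ u _; simp⟩
  add_mem' := by
    rintro a b ⟨s, hs⟩ ⟨t, ht⟩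
    refine ⟨s ∪ t, ?_⟩
    intro k hk u hu
    simp only [Finset.mem_union, not_or] at hk
    simp [LinearMap.add_apply, hs k hk.1 u hu, ht k hk.2 u hu]
  smul_mem' := by
    rintro r a ⟨s, hs⟩
    refine ⟨s, ?_⟩
    intro k hk u hu
    simp [LinearMap.smul_apply, hs k hk u hu]

/-- The weight-`k` component `V₍ₖ₎* ⊆ V'` of the graded dual: functionals
vanishing on every component of weight other than `k`. -/
def gradedDualPiece (gr : ℤ → Submodule F V) (k : ℤ) :
    Submodule F ↥(gradedDual F gr) where
  carrier := {φ | ∀ j : ℤ, j ≠ k → ∀ u ∈ gr j, (φ : Module.Dual F V) u = 0}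
  zero_mem' := by intro j _ u _; simp
  add_mem' := by
    intro a b ha hb j hj u hu
    simp [ha j hj u hu, hb j hj u hu]
  smul_mem' := by
    intro r a ha j hj u hu
    simp [ha j hj u hu]

/-- The natural pairing of `V' ⊗ V'` with `V ⊗ V`. -/
def pairVV (gr : ℤ → Submodule F V) :
    ↥(gradedDual F gr) ⊗[F] ↥(gradedDual F gr) →ₗ[F] Module.Dual F (V ⊗[F] V) :=
  TensorProduct.dualDistrib F V V ∘ₗ
    TensorProduct.map (gradedDual F gr).subtype (gradedDual F gr).subtype

/-- The covacuum map on the graded dual: evaluation at the vacuum. -/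
def covac (gr : ℤ → Submodule F V) (one : V) : ↥(gradedDual F gr) →ₗ[F] F :=
  LinearMap.applyₗ one ∘ₗ (gradedDual F gr).subtype

/-- A bilinear form `B` on `V` extended componentwise to `V ⊗ V`. -/
def formT2 (B : V →ₗ[F] V →ₗ[F] F) : V ⊗[F] V →ₗ[F] Module.Dual F (V ⊗[F] V) :=
  TensorProduct.dualDistrib F V V ∘ₗ TensorProduct.map B B

section FormalSeries

/-- Multiplication of a formal series in two variables by the first variable. -/
def mulX : Module.End F (ℤ → ℤ → F) where
  toFun A m n := A (m - 1) n
  map_add' _ _ := rfl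
  map_smul' _ _ := rfl

/-- Multiplication of a formal series in two variables by the second variable. -/
def mulY : Module.End F (ℤ → ℤ → F) where
  toFun A m n := A m (n - 1)
  map_add' _ _ := rfl
  map_smul' _ _ := rfl

omit [CharZero F] in
lemma mulX_apply (A : ℤ → ℤ → F) (m n : ℤ) : mulX F A m n = A (m - 1) n := rfl

omit [CharZero F] in
lemma mulY_apply (A : ℤ → ℤ → F) (m n : ℤ) : mulY F A m n = A m (n - 1) := rfl

omit [CharZero F] in
lemma mulX_pow_apply (r : ℕ) (A : ℤ → ℤ → F) (m n : ℤ) :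
    (mulX F ^ r) A m n = A (m - r) n := by
  induction r generalizing m with
  | zero => simp
  | succ r ih =>
    rw [pow_succ', Module.End.mul_apply, mulX_apply, ih]
    congr 1
    push_cast
    ring

omit [CharZero F] in
lemma mulY_pow_apply (s : ℕ) (A : ℤ → ℤ → F) (m n : ℤ) :
    (mulY F ^ s) A m n = A m (n - s) := by
  induction s generalizing n with
  | zero => simp
  | succ s ih =>
    rw [pow_succ', Module.End.mul_apply, mulY_apply, ih]
    congr 1
    push_cast
    ring

omit [CharZero F] in
lemma commute_mulX_mulY : Commute (mulX F) (mulY F) := rfl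

omit [CharZero F] in
lemma commute_mulX_lin (ε : F) : Commute (mulX F) (mulX F + ε • mulY F) :=
  (Commute.refl _).add_right ((commute_mulX_mulY F).smul_right ε)

omit [CharZero F] in
lemma commute_mulY_lin (ε : F) : Commute (mulY F) (mulX F + ε • mulY F) :=
  (commute_mulX_mulY F).symm.add_right ((Commute.refl _).smul_right ε)

omit [CharZero F] in
lemma mulPoly_eq (r s t : ℕ) (ε : F) (A : ℤ → ℤ → F) :
    mulPoly F r s t ε A = (mulX F ^ r * mulY F ^ s * (mulX F + ε • mulY F) ^ t) A := by
  funext m n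
  have hc : Commute (ε • mulY F) (mulX F) := (commute_mulX_mulY F).symm.smul_left ε
  rw [Module.End.mul_apply, Module.End.mul_apply, mulX_pow_apply, mulY_pow_apply, add_comm,
    hc.add_pow]
  simp only [LinearMap.sum_apply, Finset.sum_apply, mulPoly]
  refine Finset.sum_congr rfl fun j _ => ?_
  rw [← Nat.cast_comm, Module.End.mul_apply, Module.End.mul_apply, Module.End.natCast_apply,
    smul_pow, LinearMap.smul_apply]
  simp only [Pi.smul_apply, nsmul_eq_mul, smul_eq_mul, mulY_pow_apply, mulX_pow_apply, mul_assoc]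

omit [CharZero F] in
/-- Multiplications by products of `x`, `y` and `x + y` commute. -/
lemma mulPoly_comm (r s t r' s' t' : ℕ) (ε : F) (A : ℤ → ℤ → F) :
    mulPoly F r' s' t' ε (mulPoly F r s t ε A) = mulPoly F r s t ε (mulPoly F r' s' t' ε A) := by
  simp only [mulPoly_eq, ← Module.End.mul_apply]
  congr 1
  have hXY := commute_mulX_mulY F
  have hX := commute_mulX_lin F ε
  have hY := commute_mulY_lin F ε
  have h1 : Commute (mulX F ^ r) (mulX F ^ r' * mulY F ^ s' * (mulX F + ε • mulY F) ^ t') :=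
    (((Commute.refl _).pow_pow _ _).mul_right (hXY.pow_pow _ _)).mul_right (hX.pow_pow _ _)
  have h2 : Commute (mulY F ^ s) (mulX F ^ r' * mulY F ^ s' * (mulX F + ε • mulY F) ^ t') :=
    ((hXY.symm.pow_pow _ _).mul_right ((Commute.refl _).pow_pow _ _)).mul_right (hY.pow_pow _ _)
  have h3 : Commute ((mulX F + ε • mulY F) ^ t)
      (mulX F ^ r' * mulY F ^ s' * (mulX F + ε • mulY F) ^ t') :=
    ((hX.symm.pow_pow _ _).mul_right (hY.symm.pow_pow _ _)).mul_right
      ((Commute.refl _).pow_pow _ _)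
  exact ((h1.mul_left h2).mul_left h3).symm.eq

omit [CharZero F] in
/-- Pulling the powers of `x` and `y` out of `mulPoly`. -/
lemma mulPoly_apply_eq_shift (r s t : ℕ) (ε : F) (A : ℤ → ℤ → F) (m n : ℤ) :
    mulPoly F r s t ε A m n = mulPoly F 0 0 t ε A (m - r) (n - s) := by
  simp only [mulPoly, Nat.cast_zero, sub_zero]

lemma gchoose_pascal (a : ℤ) (i : ℕ) :
    gchoose F (a + 1) (i + 1) = gchoose F a (i + 1) + gchoose F a i := by
  have hprod : ∏ j ∈ Finset.range (i + 1), (((a + 1 : ℤ) : F) - (j : F)) =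
      ((a : F) + 1) * ∏ j ∈ Finset.range i, ((a : F) - (j : F)) := by
    rw [Finset.prod_range_succ', mul_comm]
    push_cast
    congr 1
    · ring
    · exact Finset.prod_congr rfl fun j _ => by ring
  have h1 : (i.factorial : F) ≠ 0 := Nat.cast_ne_zero.2 i.factorial_ne_zero
  have h2 : ((i : F) + 1) ≠ 0 := Nat.cast_add_one_ne_zero i
  unfold gchoose
  rw [hprod, Finset.prod_range_succ, Nat.factorial_succ]
  push_cast
  field_simp
  ring

omit [CharZero F] in
/-- Negating the upper index of a binomial coefficient. -/
lemma neg_one_pow_mul_gchoose (p : ℤ) (i : ℕ) :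
    (-1 : F) ^ i * gchoose F (-p - 1) i = gchoose F (p + i) i := by
  unfold gchoose
  rw [← mul_div_assoc]
  congr 1
  have hpow : (-1 : F) ^ i = ∏ _j ∈ Finset.range i, (-1 : F) := by simp
  rw [hpow, ← Finset.prod_mul_distrib, ← Finset.prod_range_reflect]
  refine Finset.prod_congr rfl fun j hj => ?_
  have hj : j + 1 ≤ i := Finset.mem_range.1 hj
  rw [Nat.sub_sub, add_comm 1 j, Nat.cast_sub hj]
  push_cast
  ring

/-- Trinomial revision for binomial coefficients. -/
lemma gchoose_mul_gchoose (m : ℤ) (i j : ℕ) :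
    gchoose F (m + i) i * gchoose F (m + i + j) j =
      gchoose F (m + (i + j : ℕ)) (i + j) * ((i + j).choose i : F) := by
  have h1 : (i.factorial : F) ≠ 0 := Nat.cast_ne_zero.2 i.factorial_ne_zero
  have h2 : (j.factorial : F) ≠ 0 := Nat.cast_ne_zero.2 j.factorial_ne_zero
  have h3 : ((i + j).choose i : F) ≠ 0 :=
    Nat.cast_ne_zero.2 (Nat.choose_pos (Nat.le_add_right i j)).ne'
  have hch : ((i + j).choose i : F) * i.factorial * j.factorial = (i + j).factorial := by
    rw [Nat.choose_symm_add]
    exact_mod_cast Nat.add_choose_mul_factorial_mul_factorial i j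
  have hprod : ∏ l ∈ Finset.range (i + j), (((m + (i + j : ℕ) : ℤ) : F) - (l : F)) =
      (∏ l ∈ Finset.range j, (((m + i + j : ℤ) : F) - (l : F))) *
        ∏ l ∈ Finset.range i, (((m + i : ℤ) : F) - (l : F)) := by
    rw [add_comm i j, Finset.prod_range_add]
    congr 1
    · exact Finset.prod_congr rfl fun l _ => by push_cast; ring
    · exact Finset.prod_congr rfl fun l _ => by push_cast; ring
  unfold gchoose
  rw [hprod, ← hch]
  field_simp

/-- The substitution `x ↦ x + ε y`, expanded in nonnegative powers of `y`. -/
def shiftSubst (ε : F) (A : ℤ → ℤ → F) (m n : ℤ) : F :=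
  ∑ᶠ j : ℕ, (ε ^ j * gchoose F (m + j) j) * A (m + j) (n - j)

variable {F}

omit [CharZero F] in
lemma shiftSubst_eq_sum (ε : F) {A : ℤ → ℤ → F} {L : ℤ} (hA : ∀ m n, n < L → A m n = 0)
    (m n : ℤ) {K : ℕ} (hK : n - L < K) :
    shiftSubst F ε A m n =
      ∑ j ∈ Finset.range K, (ε ^ j * gchoose F (m + j) j) * A (m + j) (n - j) := by
  refine finsum_eq_sum_of_support_subset _ fun j hj => ?_
  simp only [Finset.coe_range, Set.mem_Iio]
  by_contra hlt
  exact hj (mul_eq_zero_of_right _ (hA _ _ (by omega)))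

omit [CharZero F] in
lemma shiftSubst_eq_zero (ε : F) {A : ℤ → ℤ → F} {L : ℤ} (hA : ∀ m n, n < L → A m n = 0)
    (m n : ℤ) (hn : n < L) : shiftSubst F ε A m n = 0 := by
  rw [shiftSubst_eq_sum ε hA m n (K := 0) (by simpa using hn), Finset.sum_range_zero]

omit [CharZero F] in
lemma shiftSubst_mulY (ε : F) (A : ℤ → ℤ → F) :
    shiftSubst F ε (mulY F A) = mulY F (shiftSubst F ε A) := by
  funext m n
  simp only [mulY_apply, shiftSubst, sub_right_comm]

lemma shiftSubst_mulX (ε : F) {A : ℤ → ℤ → F} {L : ℤ} (hA : ∀ m n, n < L → A m n = 0) :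
    shiftSubst F ε (mulX F A) = (mulX F + ε • mulY F) (shiftSubst F ε A) := by
  funext m n
  obtain ⟨K, hK⟩ : ∃ K : ℕ, n - L < K := ⟨(n - L).toNat + 1, by omega⟩
  change _ = shiftSubst F ε A (m - 1) n + ε * shiftSubst F ε A m (n - 1)
  rw [shiftSubst_eq_sum ε (A := mulX F A) (fun m n hn => hA _ _ hn) m n
      (K := K + 1) (by push_cast; omega),
    shiftSubst_eq_sum ε hA (m - 1) n (K := K + 1) (by push_cast; omega),
    shiftSubst_eq_sum ε hA m (n - 1) (K := K) (by omega),
    Finset.sum_range_succ', Finset.sum_range_succ', Finset.mul_sum, add_right_comm,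
    ← Finset.sum_add_distrib]
  congr 1
  · refine Finset.sum_congr rfl fun j _ => ?_
    have e1 : m + ((j + 1 : ℕ) : ℤ) = m + j + 1 := by push_cast; ring
    have e2 : m - 1 + ((j + 1 : ℕ) : ℤ) = m + j := by push_cast; ring
    have e3 : n - ((j + 1 : ℕ) : ℤ) = n - 1 - j := by push_cast; ring
    rw [mulX_apply, e1, e2, e3, gchoose_pascal, add_sub_cancel_right]
    ring
  · simp [mulX_apply, gchoose]

omit [CharZero F] in
lemma shiftSubst_mulY_pow (ε : F) (s : ℕ) (A : ℤ → ℤ → F) :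
    shiftSubst F ε ((mulY F ^ s) A) = (mulY F ^ s) (shiftSubst F ε A) := by
  induction s with
  | zero => rfl
  | succ s ih =>
    rw [pow_succ', Module.End.mul_apply, Module.End.mul_apply, shiftSubst_mulY, ih]

lemma shiftSubst_mulX_pow (ε : F) (r : ℕ) {A : ℤ → ℤ → F} {L : ℤ}
    (hA : ∀ m n, n < L → A m n = 0) :
    shiftSubst F ε ((mulX F ^ r) A) = ((mulX F + ε • mulY F) ^ r) (shiftSubst F ε A) := by
  induction r with
  | zero => rfl
  | succ r ih =>
    rw [pow_succ', Module.End.mul_apply, pow_succ', Module.End.mul_apply,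
      shiftSubst_mulX ε (L := L) (fun m n hn => by rw [mulX_pow_apply, hA _ _ hn]), ih]

/-- The substitutions `x ↦ x + y` and `x ↦ x - y` are inverse to each other. -/
lemma shiftSubst_neg_one_one {A : ℤ → ℤ → F} {L : ℤ} (hA : ∀ m n, n < L → A m n = 0) :
    shiftSubst F (-1) (shiftSubst F 1 A) = A := by
  funext m n
  obtain ⟨K, hK⟩ : ∃ K : ℕ, n - L < K := ⟨(n - L).toNat + 1, by omega⟩
  rw [shiftSubst_eq_sum (-1) (shiftSubst_eq_zero 1 hA) m n (K := K + 1) (by push_cast; omega)]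
  have hin : ∀ i ∈ Finset.range (K + 1),
      ((-1 : F) ^ i * gchoose F (m + i) i) * shiftSubst F 1 A (m + i) (n - i) =
        ∑ j ∈ Finset.range (K + 1 - i), (-1 : F) ^ i * ((i + j).choose i : F) *
          (gchoose F (m + (i + j : ℕ)) (i + j) * A (m + (i + j : ℕ)) (n - (i + j : ℕ))) := by
    intro i hi
    have hi : i ≤ K := Nat.lt_succ_iff.1 (Finset.mem_range.1 hi)
    rw [shiftSubst_eq_sum 1 hA (m + i) (n - i) (K := K + 1 - i) (by omega), Finset.mul_sum]
    refine Finset.sum_congr rfl fun j _ => ?_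
    have e1 : m + i + j = m + ((i + j : ℕ) : ℤ) := by push_cast; ring
    have e2 : n - i - j = n - ((i + j : ℕ) : ℤ) := by push_cast; ring
    have := gchoose_mul_gchoose F m i j
    rw [e1] at this
    rw [e1, e2, one_pow, one_mul]
    linear_combination ((-1 : F) ^ i * A (m + ((i + j : ℕ) : ℤ)) (n - ((i + j : ℕ) : ℤ))) * this
  rw [Finset.sum_congr rfl hin, ← Finset.sum_range_diag_flip (K + 1) fun i j =>
    (-1 : F) ^ i * ((i + j).choose i : F) *
      (gchoose F (m + (i + j : ℕ)) (i + j) * A (m + (i + j : ℕ)) (n - (i + j : ℕ)))]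
  have hdiag : ∀ l ∈ Finset.range (K + 1), ∑ i ∈ Finset.range (l + 1),
      (-1 : F) ^ i * ((i + (l - i)).choose i : F) * (gchoose F (m + (i + (l - i) : ℕ))
        (i + (l - i)) * A (m + (i + (l - i) : ℕ)) (n - (i + (l - i) : ℕ))) =
      if l = 0 then A m n else 0 := by
    intro l _
    have halt : ∑ i ∈ Finset.range (l + 1), (-1 : F) ^ i * (l.choose i : F) =
        if l = 0 then 1 else 0 := by
      exact_mod_cast congrArg (Int.cast : ℤ → F) (Int.alternating_sum_range_choose (n := l))
    calc
      _ = ∑ i ∈ Finset.range (l + 1), (-1 : F) ^ i * (l.choose i : F) *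
          (gchoose F (m + l) l * A (m + l) (n - l)) := by
        refine Finset.sum_congr rfl fun i hi => ?_
        rw [Nat.add_sub_cancel' (Nat.lt_succ_iff.1 (Finset.mem_range.1 hi))]
      _ = _ := by
        rw [← Finset.sum_mul, halt]
        split_ifs with hl
        · subst hl
          simp [gchoose]
        · rw [zero_mul]
  rw [Finset.sum_congr rfl hdiag, Finset.sum_ite_eq' (Finset.range (K + 1)) 0]
  simp

end FormalSeries

section Grading

variable {F} {gr : ℤ → Submodule F V} {grM : ℚ → Submodule F M}
  {ΔV : ℤ → V →ₗ[F] V ⊗[F] V} {ΔM : ℤ → M →ₗ[F] V ⊗[F] M}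

omit [CharZero F] in
lemma tmul_mem_grVVM {p p' : ℤ} {q q' : ℚ} {a b : V} {u : M} (ha : a ∈ gr p) (hb : b ∈ gr p')
    (hu : u ∈ grM q) (hq : q' = p + p' + q) : a ⊗ₜ[F] (b ⊗ₜ[F] u) ∈ grVVM F gr grM q' := by
  have hu' : u ∈ grM (q' - p - p') := by
    convert hu using 2
    rw [hq]
    ring
  exact Submodule.mem_iSup_of_mem (p, p') ⟨⟨a, ha⟩ ⊗ₜ (⟨b, hb⟩ ⊗ₜ ⟨u, hu'⟩), rfl⟩

omit [CharZero F] in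
/-- A linear map sends a graded piece of `V ⊗ M` into a submodule as soon as it does so for
pure tensors of homogeneous elements. -/
lemma map_mem_of_mem_grVM {E : Type} [AddCommGroup E] [Module F E] (g : V ⊗[F] M →ₗ[F] E)
    (S : Submodule F E) (q : ℚ)
    (h : ∀ (p : ℤ), ∀ a ∈ gr p, ∀ u ∈ grM (q - p), g (a ⊗ₜ u) ∈ S)
    {x : V ⊗[F] M} (hx : x ∈ grVM F gr grM q) : g x ∈ S := by
  refine (iSup_le fun p => ?_ : grVM F gr grM q ≤ S.comap g) hx
  rintro _ ⟨x, rfl⟩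
  rw [Submodule.mem_comap]
  induction x using TensorProduct.induction_on with
  | zero => simp
  | tmul a u => exact h p a a.2 u u.2
  | add x y hx hy => rw [map_add, map_add]; exact S.add_mem hx hy

omit [CharZero F] in
lemma map_mem_of_mem_grT2 {E : Type} [AddCommGroup E] [Module F E] (g : V ⊗[F] V →ₗ[F] E)
    (S : Submodule F E) (q : ℤ)
    (h : ∀ (p : ℤ), ∀ a ∈ gr p, ∀ b ∈ gr (q - p), g (a ⊗ₜ b) ∈ S)
    {x : V ⊗[F] V} (hx : x ∈ grT2 F gr q) : g x ∈ S := by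
  refine (iSup_le fun p => ?_ : grT2 F gr q ≤ S.comap g) hx
  rintro _ ⟨x, rfl⟩
  rw [Submodule.mem_comap]
  induction x using TensorProduct.induction_on with
  | zero => simp
  | tmul a u => exact h p a a.2 u u.2
  | add x y hx hy => rw [map_add, map_add]; exact S.add_mem hx hy

omit [CharZero F] in
lemma comp12_mem_grVVM
    (hM : ∀ (j : ℚ) (k : ℤ), ∀ w ∈ grM j, ΔM k w ∈ grVM F gr grM (j + k + 1))
    {j : ℚ} {w : M} (hw : w ∈ grM j) (m n : ℤ) :
    comp12 F ΔM m n w ∈ grVVM F gr grM (j + m + n + 2) := by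
  refine map_mem_of_mem_grVM (TensorProduct.map LinearMap.id (ΔM n)) _ _ (fun p a ha u hu => ?_)
    (hM j m w hw)
  refine map_mem_of_mem_grVM (TensorProduct.mk F V (V ⊗[F] M) a) _ _ (fun p' b hb x hx => ?_)
    (hM _ n u hu)
  exact tmul_mem_grVVM ha hb hx (by ring)

omit [CharZero F] in
lemma compR_mem_grVVM
    (hV : ∀ r k : ℤ, ∀ v ∈ gr r, ΔV k v ∈ grT2 F gr (r + k + 1))
    (hM : ∀ (j : ℚ) (k : ℤ), ∀ w ∈ grM j, ΔM k w ∈ grVM F gr grM (j + k + 1))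
    {j : ℚ} {w : M} (hw : w ∈ grM j) (m n : ℤ) :
    compR F ΔV ΔM m n w ∈ grVVM F gr grM (j + m + n + 2) := by
  refine map_mem_of_mem_grVM ((TensorProduct.assoc F V V M).toLinearMap ∘ₗ
    TensorProduct.map (ΔV m) LinearMap.id) _ _ (fun p v hv u hu => ?_) (hM j n w hw)
  refine map_mem_of_mem_grT2 ((TensorProduct.assoc F V V M).toLinearMap ∘ₗ
    (TensorProduct.mk F (V ⊗[F] V) M).flip u) _ _ (fun p' a ha b hb => ?_) (hV p m v hv)
  exact tmul_mem_grVVM ha hb hu (by push_cast; ring)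

omit [CharZero F] in
/-- Paired with an element of the graded dual, both iterated coproducts of a vector are
supported on finitely many diagonals. -/
lemma exists_diagonal_bound (hint : DirectSum.IsInternal grM)
    (hV : ∀ r k : ℤ, ∀ v ∈ gr r, ΔV k v ∈ grT2 F gr (r + k + 1))
    (hM : ∀ (j : ℚ) (k : ℤ), ∀ w ∈ grM j, ΔM k w ∈ grVM F gr grM (j + k + 1))
    {f : V ⊗[F] (V ⊗[F] M) →ₗ[F] F} (hf : GradedDualVVM F gr grM f) (w : M) :
    ∃ D : ℤ, ∀ m n : ℤ, D < |m + n| →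
      f (comp12 F ΔM m n w) = 0 ∧ f (compR F ΔV ΔM m n w) = 0 := by
  obtain ⟨s, hs⟩ := hf
  have hw : w ∈ ⨆ j, grM j := by rw [hint.submodule_iSup_eq_top]; trivial
  induction hw using Submodule.iSup_induction' with
  | zero => exact ⟨0, fun m n _ => by simp⟩
  | add x y _ _ hx hy =>
    obtain ⟨D, hD⟩ := hx
    obtain ⟨E, hE⟩ := hy
    refine ⟨max D E, fun m n h => ?_⟩
    obtain ⟨h1, h2⟩ := hD m n ((le_max_left _ _).trans_lt h)
    obtain ⟨h3, h4⟩ := hE m n ((le_max_right _ _).trans_lt h)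
    simp only [map_add, h1, h2, h3, h4, add_zero, and_self]
  | mem j w hw =>
    refine ⟨⌈∑ q ∈ s, |q| + |j| + 2⌉, fun m n h => ?_⟩
    have hns : j + m + n + 2 ∉ s := fun hmem => by
      have h1 : |j + m + n + 2| ≤ ∑ q ∈ s, |q| :=
        Finset.single_le_sum (f := fun q : ℚ => |q|) (fun q _ => abs_nonneg q) hmem
      have h2 : ∑ q ∈ s, |q| + |j| + 2 < |(m : ℚ) + n| := by
        exact_mod_cast (Int.le_ceil _).trans_lt (Int.cast_lt.2 h)
      have h3 : |(m : ℚ) + n| ≤ |j + m + n + 2| + |j| + 2 := by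
        rw [abs_le]
        constructor <;> linarith [neg_abs_le (j + m + n + 2), le_abs_self (j + m + n + 2),
          neg_abs_le j, le_abs_self j]
      linarith
    exact ⟨hs _ hns _ (comp12_mem_grVVM hM hw m n), hs _ hns _ (compR_mem_grVVM hV hM hw m n)⟩

omit [CharZero F] in
/-- Weak coassociativity as an identity of formal series. -/
lemma WeakCoassoc.mulPoly_eq {f : V ⊗[F] (V ⊗[F] M) →ₗ[F] F} {k : ℕ}
    (hk : WeakCoassoc F ΔV ΔM f k) (w : M) :
    mulPoly F 0 0 k 1 (fun m n => f (compR F ΔV ΔM (-m - 1) (-n - 1) w)) =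
      mulPoly F 0 0 k 1 (shiftSubst F 1 fun m n => f (comp12 F ΔM (-m - 1) (-n - 1) w)) := by
  funext m n
  rw [← sub_eq_zero, ← hk w (-m - 1) (-n - 1)]
  unfold mulPoly
  rw [← Finset.sum_sub_distrib]
  refine Finset.sum_congr rfl fun j hj => ?_
  have hj : j ≤ k := Nat.lt_succ_iff.1 (Finset.mem_range.1 hj)
  rw [← mul_sub, one_pow, mul_one, Nat.cast_sub hj]
  have e1 : -(m - (0 : ℕ) - (k - j : ℤ)) - 1 = -m - 1 + k - j := by push_cast; ring
  have e2 : -(n - (0 : ℕ) - (j : ℤ)) - 1 = -n - 1 + j := by push_cast; ring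
  beta_reduce
  rw [e1, e2]
  refine congrArg (fun z => (k.choose j : F) * (_ - z)) (finsum_congr fun i => ?_)
  have e3 : -(m - (0 : ℕ) - (k - j : ℤ) + i) - 1 = -m - 1 + k - j - i := by push_cast; ring
  have e4 : -(n - (0 : ℕ) - (j : ℤ) - i) - 1 = -n - 1 + j + i := by push_cast; ring
  beta_reduce
  rw [e3, e4, ← e1, neg_one_pow_mul_gchoose, one_pow, one_mul]

end Grading

/-- Left rationality and coassociativity for comodules: Let `M`
satisfy all the axioms of a comodule over a graded vertex coalgebra `(V, Y_V, c)`
except possibly the Jacobi identity, together with weak coassociativity.  Then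
for every `v' ∈ (V ⊗ V ⊗ M)'` and `w ∈ M`:
(a) `⟨v', (Y_V(x₀) ⊗ Id)Y_M(x₂)w⟩` lies in `F[x₀⁻¹,x₂][[x₀,x₂⁻¹]]` and equals
`ι₂₀ k` for a uniquely determined rational function `k = h/(x₀^r x₂^s (x₀+x₂)^t)`;
(b) `ι₁₂⁻¹⟨v', (Id ⊗ Y_M(x₂))Y_M(x₁)w⟩ = (ι₂₀⁻¹⟨v', (Y_V(x₀) ⊗ Id)Y_M(x₂)w⟩)|_{x₀=x₁-x₂}`.
Rendered coefficient-wise as in the algebra case. -/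
theorem comodule_left_rationality_and_coassociativity
    (ΔV : ℤ → V →ₗ[F] V ⊗[F] V) (c : V →ₗ[F] F) (gr : ℤ → Submodule F V)
    (hVC : IsVertexCoalg F ΔV c) (hgr : IsGradedVC F ΔV gr)
    (ΔM : ℤ → M →ₗ[F] V ⊗[F] M) (grM : ℚ → Submodule F M)
    (hmod : IsComoduleSansJacobi F c ΔM gr grM)
    (hwassoc : ∀ (f : V ⊗[F] (V ⊗[F] M) →ₗ[F] F), GradedDualVVM F gr grM f →
      ∃ k : ℕ, 0 < k ∧ WeakCoassoc F ΔV ΔM f k)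
    (f : V ⊗[F] (V ⊗[F] M) →ₗ[F] F) (hf : GradedDualVVM F gr grM f) (w : M)
    (A : ℤ → ℤ → F) (hA : A = fun m n => f (comp12 F ΔM (-m - 1) (-n - 1) w))
    (C : ℤ → ℤ → F) (hC : C = fun m n => f (compR F ΔV ΔM (-m - 1) (-n - 1) w)) :
    (∃ N : ℤ, ∀ m n : ℤ, (m < -N → C m n = 0) ∧ (N < n → C m n = 0)) ∧
    ∃ (h : ℤ → ℤ → F) (r s t : ℕ), IsPolyCoeff F h ∧
      (∀ m n : ℤ, mulPoly F r s t 1 C m n = h m n) ∧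
      (∀ m n : ℤ, mulPoly F t s r (-1) A m n = substC F h m n) ∧
      (∀ (h' : ℤ → ℤ → F) (r' s' t' : ℕ), IsPolyCoeff F h' →
        (∀ m n : ℤ, mulPoly F r' s' t' 1 C m n = h' m n) →
        ∀ m n : ℤ, mulPoly F r' s' t' 1 h m n = mulPoly F r s t 1 h' m n) := by
  obtain ⟨-, -, htr, hint, -, hM⟩ := hmod
  obtain ⟨D, hD⟩ := exists_diagonal_bound hint hgr.2.2 hM hf w
  obtain ⟨T, hT⟩ := htr w
  obtain ⟨k, -, hk⟩ := hwassoc f hf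
  obtain ⟨K, hK⟩ : ∃ K : ℕ, D + 2 ≤ K ∧ -T - 1 ≤ K := ⟨(max (D + 2) (-T - 1)).toNat, by omega⟩
  have hQ : mulPoly F 0 0 k 1 C = mulPoly F 0 0 k 1 (shiftSubst F 1 A) := by
    rw [hA, hC]
    exact hk.mulPoly_eq w
  have hdiag : ∀ m n : ℤ, K < |m + n| → A m n = 0 ∧ C m n = 0 := by
    intro m n hmn
    rw [hA, hC]
    exact hD _ _ (by grind)
  have hA1 : ∀ m n : ℤ, K < m → A m n = 0 := by
    intro m n hm
    simp [hA, comp12, hT (-m - 1) (by omega)]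
  have hC2 : ∀ m n : ℤ, K < n → C m n = 0 := by
    intro m n hn
    simp [hC, compR, hT (-n - 1) (by omega)]
  have hA2 : ∀ m n : ℤ, n < -(2 * K) → A m n = 0 := by
    intro m n hn
    by_cases hm : K < m
    · exact hA1 m n hm
    · exact (hdiag m n (by grind)).1
  have hC1 : ∀ m n : ℤ, m < -(2 * K) → C m n = 0 := by
    intro m n hm
    by_cases hn : K < n
    · exact hC2 m n hn
    · exact (hdiag m n (by grind)).2
  have hsupp : ∀ m n : ℤ, m < -(2 * K) ∨ K + k < n ∨ n < -(2 * K) ∨ 3 * K + k < m →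
      mulPoly F 0 0 k 1 C m n = 0 := by
    intro m n hmn
    by_cases hn : n < -(2 * K)
    · rw [hQ]
      refine Finset.sum_eq_zero fun j hj => mul_eq_zero_of_right _ ?_
      exact shiftSubst_eq_zero 1 hA2 _ _ (by omega)
    · refine Finset.sum_eq_zero fun j hj => mul_eq_zero_of_right _ ?_
      have hj := Finset.mem_range.1 hj
      by_cases h1 : m < -(2 * K)
      · exact hC1 _ _ (by omega)
      · by_cases h2 : K + k < n
        · exact hC2 _ _ (by omega)
        · exact (hdiag _ _ (lt_of_lt_of_le (by omega) (le_abs_self _))).2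
  refine ⟨⟨2 * K, fun m n => ⟨hC1 m n, fun hn => hC2 m n (by omega)⟩⟩,
    mulPoly F (2 * K) (2 * K) k 1 C, 2 * K, 2 * K, k, ⟨?_, ?_⟩, fun _ _ => rfl, ?_, ?_⟩
  · refine ((Set.finite_Icc (0 : ℤ) (5 * K + k)).prod
      (Set.finite_Icc (0 : ℤ) (3 * K + k))).subset fun p hp => ?_
    by_contra hcon
    refine hp ?_
    simp only [Set.mem_prod, Set.mem_Icc] at hcon
    rw [mulPoly_apply_eq_shift]
    exact hsupp _ _ (by push_cast; omega)
  · intro m n hmn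
    rw [mulPoly_apply_eq_shift]
    exact hsupp _ _ (by push_cast; omega)
  · intro m n
    change _ = shiftSubst F (-1) _ m n
    have hlin : ((mulX F + (1 : F) • mulY F) ^ k) (shiftSubst F 1 A) =
        shiftSubst F 1 ((mulX F ^ k) A) := (shiftSubst_mulX_pow 1 k hA2).symm
    have hXA : ∀ m n : ℤ, n < -(2 * K) → (mulX F ^ k) A m n = 0 := fun m n hn => by
      rw [mulX_pow_apply, hA2 _ _ hn]
    have hSh := shiftSubst_eq_zero (1 : F) hXA
    have hL : ∀ m n : ℤ, n < 0 →
        (mulY F ^ (2 * K)) (shiftSubst F 1 ((mulX F ^ k) A)) m n = 0 := fun m n hn => by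
      rw [mulY_pow_apply]
      exact hSh _ _ (by push_cast; omega)
    have hC' : mulPoly F (2 * K) (2 * K) k 1 C =
        (mulX F ^ (2 * K)) ((mulY F ^ (2 * K)) (shiftSubst F 1 ((mulX F ^ k) A))) := by
      rw [← hlin, ← Module.End.mul_apply, ← Module.End.mul_apply, ← mulPoly_eq]
      funext m n
      rw [mulPoly_apply_eq_shift, hQ, ← mulPoly_apply_eq_shift]
    rw [hC', shiftSubst_mulX_pow (-1) _ hL, shiftSubst_mulY_pow, shiftSubst_neg_one_one hXA,
      mulPoly_eq, ← Module.End.mul_apply, ← Module.End.mul_apply]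
    rw [(((commute_mulX_lin F (-1)).pow_pow k (2 * K)).mul_left
      ((commute_mulY_lin F (-1)).pow_pow (2 * K) (2 * K))).eq,
      ((commute_mulX_mulY F).pow_pow k (2 * K)).eq]
    rfl
  · intro h' r' s' t' _ hh' m n
    have : mulPoly F r' s' t' 1 C = h' := funext fun m => funext fun n => hh' m n
    rw [← this, mulPoly_comm]
end
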